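/- Let m ≥ 2 and n ∈ ℕ₀, and write n in base m as n = a_0 + a_1·m + ⋯ + a_s·m^s with digits 0 ≤ a_j ≤ m−1. Then b_m(mn) ≡ ∏_{j=0}^s (a_j + 1) (mod m). -/

import Mathlib

/-- The number of `m`-ary partitions of `n`. -/
noncomputable def mAryPartitions (m n : ℕ) : ℕ :=
  Nat.card {f : ℕ →₀ ℕ // (f.sum fun i c => c * m ^ i) = n}

/-- weight of an exponent vector -/
def wgt (m : ℕ) (f : ℕ →₀ ℕ) : ℕ := f.sum fun i c => c * m ^ i

/-- prepend a coefficient -/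
noncomputable def consF (c : ℕ) (g : ℕ →₀ ℕ) : ℕ →₀ ℕ :=
  Finsupp.single 0 c + g.mapDomain Nat.succ

lemma consF_succ (c : ℕ) (g : ℕ →₀ ℕ) (i : ℕ) : consF c g (i + 1) = g i := by
  have := Finsupp.mapDomain_apply Nat.succ_injective g i
  simp only [Nat.succ_eq_add_one] at this
  simp [consF, this]

lemma consF_zero (c : ℕ) (g : ℕ →₀ ℕ) : consF c g 0 = c := by
  have : g.mapDomain Nat.succ 0 = 0 := Finsupp.mapDomain_notin_range g 0 (by simp)
  simp [consF, this]

lemma wgt_consF (m c : ℕ) (g : ℕ →₀ ℕ) : wgt m (consF c g) = c + m * wgt m g := by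
  unfold wgt consF
  rw [Finsupp.sum_add_index' (by simp) (by intros; ring),
    Finsupp.sum_mapDomain_index (by simp) (by intros; ring)]
  rw [Finsupp.sum_single_index (by simp), Finsupp.mul_sum]
  simp only [pow_zero, mul_one]
  congr 1
  apply Finsupp.sum_congr
  intro i _
  rw [Nat.succ_eq_add_one]; ring

lemma exists_consF (f : ℕ →₀ ℕ) : ∃ g, f = consF (f 0) g := by
  refine ⟨f.comapDomain Nat.succ Nat.succ_injective.injOn, ?_⟩
  ext i
  cases i with
  | zero => rw [consF_zero]
  | succ i => rw [consF_succ]; simp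

/-- the recursion map -/
noncomputable def recMap (m : ℕ) (hm : 2 ≤ m) (n : ℕ) :
    (Σ k : Fin (n / m + 1), {g : ℕ →₀ ℕ // wgt m g = k}) → {f : ℕ →₀ ℕ // wgt m f = n} :=
  fun x => ⟨consF (n - m * x.1) x.2.1, by
    rw [wgt_consF, x.2.2]
    have h : (x.1 : ℕ) ≤ n / m := Nat.lt_succ_iff.mp x.1.2
    have := (Nat.mul_le_mul_left m h).trans (Nat.mul_div_le n m)
    omega⟩

lemma recMap_bij (m : ℕ) (hm : 2 ≤ m) (n : ℕ) : Function.Bijective (recMap m hm n) := by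
  constructor
  · rintro ⟨⟨k, hk⟩, ⟨g, hg⟩⟩ ⟨⟨k', hk'⟩, ⟨g', hg'⟩⟩ h
    have h1 := congrArg Subtype.val h
    simp only [recMap] at h1
    have : g = g' := by
      ext i
      have := DFunLike.congr_fun h1 (i + 1)
      rwa [consF_succ, consF_succ] at this
    subst this
    simp only at hg hg'
    subst hg
    subst hg'
    rfl
  · rintro ⟨f, hf⟩
    obtain ⟨g, hg⟩ := exists_consF f
    have h := wgt_consF m (f 0) g
    rw [← hg, hf] at h
    refine ⟨⟨⟨wgt m g, ?_⟩, ⟨g, rfl⟩⟩, ?_⟩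
    · rw [Nat.lt_succ_iff, Nat.le_div_iff_mul_le (by omega), mul_comm]; omega
    · apply Subtype.ext
      simp only [recMap]
      rw [show n - m * wgt m g = f 0 by omega]
      exact hg.symm

lemma wgt_zero_iff (m : ℕ) (hm : 2 ≤ m) (f : ℕ →₀ ℕ) : wgt m f = 0 ↔ f = 0 := by
  constructor
  · intro h
    ext i
    by_contra hi
    have h2 := (Finset.sum_eq_zero_iff.mp h) i (by simpa using hi)
    have : m ^ i ≠ 0 := by positivity
    simp_all
  · rintro rfl; simp [wgt]

lemma card_zero (m : ℕ) (hm : 2 ≤ m) : mAryPartitions m 0 = 1 := by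
  change Nat.card {f : ℕ →₀ ℕ // wgt m f = 0} = 1
  simp [wgt_zero_iff m hm]

lemma fin_wgt (m : ℕ) (hm : 2 ≤ m) (n : ℕ) : Finite {f : ℕ →₀ ℕ // wgt m f = n} := by
  induction n using Nat.strong_induction_on with
  | _ n ih =>
    rcases Nat.eq_zero_or_pos n with rfl | hn
    · simp only [wgt_zero_iff m hm]; infer_instance
    · have : ∀ k : Fin (n / m + 1), Finite {g : ℕ →₀ ℕ // wgt m g = k} := fun k =>
        ih k (lt_of_le_of_lt (Nat.lt_succ_iff.mp k.2) (Nat.div_lt_self hn hm))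
      exact Finite.of_surjective _ (recMap_bij m hm n).2

lemma card_rec (m : ℕ) (hm : 2 ≤ m) (n : ℕ) :
    mAryPartitions m n = ∑ k ∈ Finset.range (n / m + 1), mAryPartitions m k := by
  have := fin_wgt m hm
  change Nat.card {f : ℕ →₀ ℕ // wgt m f = n} = _
  rw [← Nat.card_congr (Equiv.ofBijective _ (recMap_bij m hm n)), Nat.card_sigma,
    Finset.sum_range]
  rfl

lemma card_add (m : ℕ) (hm : 2 ≤ m) (q r : ℕ) (hr : r < m) :
    mAryPartitions m (m * q + r) = mAryPartitions m (m * q) := by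
  rw [card_rec m hm (m * q + r), card_rec m hm (m * q),
    Nat.mul_add_div (by omega), Nat.div_eq_of_lt hr, Nat.mul_div_cancel_left _ (by omega)]

lemma sum_block (m : ℕ) (hm : 2 ≤ m) (q r : ℕ) (hr : r ≤ m) :
    ∑ k ∈ Finset.range (m * q + r), mAryPartitions m k =
      ∑ k ∈ Finset.range (m * q), mAryPartitions m k + r * mAryPartitions m (m * q) := by
  rw [Finset.sum_range_add, Finset.sum_congr rfl (fun x hx =>
    card_add m hm q x (lt_of_lt_of_le (Finset.mem_range.mp hx) hr))]
  simp

lemma dvd_block (m : ℕ) (hm : 2 ≤ m) (q : ℕ) :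
    m ∣ ∑ k ∈ Finset.range (m * q), mAryPartitions m k := by
  induction q with
  | zero => simp
  | succ q ih =>
    rw [mul_add, mul_one, sum_block m hm q m le_rfl]
    exact dvd_add ih (dvd_mul_right _ _)

lemma card_step (m : ℕ) (hm : 2 ≤ m) (q r : ℕ) (hr : r < m) :
    mAryPartitions m (m * (r + m * q)) ≡ (r + 1) * mAryPartitions m (m * q) [MOD m] := by
  rw [card_rec m hm (m * _), Nat.mul_div_cancel_left _ (by omega),
    show r + m * q + 1 = m * q + (r + 1) by ring, sum_block m hm q (r + 1) hr]
  have := (Nat.modEq_zero_iff_dvd.mpr (dvd_block m hm q)).add_right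
    ((r + 1) * mAryPartitions m (m * q))
  simpa using this

/-- Proposition 1 (charactb) of the paper. -/
theorem stmt_13 (m : ℕ) (hm : 2 ≤ m) (n s : ℕ) (a : ℕ → ℕ)
    (ha : ∀ j : ℕ, j ≤ s → a j ≤ m - 1)
    (hn : n = ∑ j ∈ Finset.range (s + 1), a j * m ^ j) :
    mAryPartitions m (m * n) ≡ ∏ j ∈ Finset.range (s + 1), (a j + 1) [MOD m] := by
  have key : ∀ (t : ℕ) (a : ℕ → ℕ), (∀ j, j < t → a j ≤ m - 1) →
      mAryPartitions m (m * ∑ j ∈ Finset.range t, a j * m ^ j) ≡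
        ∏ j ∈ Finset.range t, (a j + 1) [MOD m] := by
    intro t
    induction t with
    | zero => intro a _; simp [card_zero m hm, Nat.ModEq]
    | succ t ih =>
      intro a ha
      have h0 := ha 0 (by omega)
      have e : ∑ j ∈ Finset.range (t + 1), a j * m ^ j =
          a 0 + m * ∑ j ∈ Finset.range t, a (j + 1) * m ^ j := by
        rw [Finset.sum_range_succ', Finset.mul_sum, add_comm]
        congr 1
        · simp
        · exact Finset.sum_congr rfl fun j _ => by ring
      rw [e, Finset.prod_range_succ', mul_comm (∏ j ∈ _, _)]
      exact (card_step m hm _ _ (by omega)).trans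
        ((ih (fun j => a (j + 1)) fun j hj => ha (j + 1) (by omega)).mul_left _)
  rw [hn]
  exact key (s + 1) a fun j hj => ha j (by omega)
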